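/- Let P be a partial order containing arbitrarily large finite strong antichains, and let S ⊆ P be a finite strong antichain that is maximal with respect to inclusion. Then there exists x ∈ S such that the upper cone ↑x = {y ∈ P : x ≤ y} contains arbitrarily large finite strong antichains (i.e., for every k there is a strong antichain of P of size at least k contained in ↑x). -/

import Mathlib

/-- A strong antichain: a set of pairwise incompatible elements. -/
def IsStrongAntichainPO {α : Type*} [PartialOrder α] (S : Set α) : Prop :=
  ∀ x ∈ S, ∀ y ∈ S, x ≠ y → ¬ ∃ z, x ≤ z ∧ y ≤ z

/-- Every element is compatible with some member of a maximal strong antichain. -/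
theorem IsStrongAntichainPO.exists_compatible_of_maximal {α : Type*} [PartialOrder α] {S : Set α}
    (hS : IsStrongAntichainPO S)
    (hmaxS : ∀ T : Set α, IsStrongAntichainPO T → S ⊆ T → T = S) (t : α) :
    ∃ s ∈ S, ∃ z, s ≤ z ∧ t ≤ z := by
  by_contra! h
  have hins : IsStrongAntichainPO (insert t S) := by
    rintro x (rfl | hx) y (rfl | hy) hne ⟨z, hxz, hyz⟩
    · exact hne rfl
    · exact h y hy z hyz hxz
    · exact h x hx z hxz hyz
    · exact hS x hx y hy hne ⟨z, hxz, hyz⟩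
  have ht : t ∈ S := hmaxS _ hins (Set.subset_insert t S) ▸ Set.mem_insert t S
  exact h t ht t le_rfl le_rfl

/-- Moving the elements of a finite strong antichain upwards gives a strong antichain of the same
size. -/
theorem IsStrongAntichainPO.exists_image_of_le {α : Type*} [PartialOrder α] {T : Finset α}
    (hT : IsStrongAntichainPO (T : Set α)) {f : α → α} (hf : ∀ t, t ≤ f t) :
    ∃ U : Finset α, IsStrongAntichainPO (U : Set α) ∧ (U : Set α) = f '' T ∧
      U.card = T.card := by
  classical
  refine ⟨T.image f, ?_, Finset.coe_image, Finset.card_image_of_injOn ?_⟩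
  · rw [Finset.coe_image]
    rintro _ ⟨x, hx, rfl⟩ _ ⟨y, hy, rfl⟩ hne ⟨z, hxz, hyz⟩
    exact hT x hx y hy (fun h => hne (congrArg f h)) ⟨z, (hf x).trans hxz, (hf y).trans hyz⟩
  · intro x hx y hy hxy
    by_contra hne
    exact hT x hx y hy hne ⟨f x, hf x, hxy ▸ hf y⟩

/-- If a partial order contains arbitrarily large finite strong antichains and `S` is a
finite strong antichain maximal with respect to inclusion, then some upper cone `↑x`
with `x ∈ S` contains arbitrarily large finite strong antichains. -/
theorem stmt9 {α : Type*} [PartialOrder α]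
    (harb : ∀ k : ℕ, ∃ T : Finset α, IsStrongAntichainPO (↑T : Set α) ∧ k ≤ T.card)
    (S : Finset α) (hS : IsStrongAntichainPO (↑S : Set α))
    (hmaxS : ∀ T : Set α, IsStrongAntichainPO T → (↑S : Set α) ⊆ T → T = ↑S) :
    ∃ x ∈ S, ∀ k : ℕ, ∃ T : Finset α, IsStrongAntichainPO (↑T : Set α) ∧
      (↑T : Set α) ⊆ {y : α | x ≤ y} ∧ k ≤ T.card := by
  classical
  choose g hgS f hgf hf using hS.exists_compatible_of_maximal hmaxS
  by_contra! h
  choose! k hk using h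
  obtain ⟨T, hT, hcard⟩ := harb (S.card * S.sup k + 1)
  obtain ⟨x, hx, hlt⟩ := Finset.exists_lt_card_fiber_of_mul_lt_card_of_maps_to
    (fun t _ => hgS t) (Nat.lt_of_succ_le hcard)
  have hfiber : IsStrongAntichainPO (↑(T.filter (g · = x)) : Set α) := fun a ha b hb =>
    hT a (Finset.mem_of_mem_filter a ha) b (Finset.mem_of_mem_filter b hb)
  obtain ⟨U, hU, hUf, hUcard⟩ := hfiber.exists_image_of_le hf
  refine (hk x hx U hU ?_).not_ge (hUcard ▸ (Finset.le_sup hx).trans hlt.le)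
  rw [hUf]
  rintro _ ⟨t, ht, rfl⟩
  exact (Finset.mem_filter.mp ht).2 ▸ hgf t
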